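/- Let H₁ and H₂ be nonzero separable complex Hilbert spaces and let φ be a bimodule endomorphism of K(H₁,H₂). Then φ preserves the complex line of every rank-one operator: for all u ∈ H₂ and v ∈ H₁ there exists λ ∈ ℂ (possibly depending on u and v) such that φ(u ⊗ v̄) = λ • (u ⊗ v̄), where u ⊗ v̄ denotes the rank-one operator w ↦ ⟨w, v⟩ u. -/

import Mathlib

/-- The rank-one operator `u ⊗ v̄ : H₁ → H₂`, `w ↦ ⟨w, v⟩ u` (inner product antilinear in `v`,
written in Mathlib's convention as `w ↦ ⟪v, w⟫ • u`). -/
noncomputable def rankOne {H₁ H₂ : Type*}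
    [NormedAddCommGroup H₁] [InnerProductSpace ℂ H₁]
    [NormedAddCommGroup H₂] [InnerProductSpace ℂ H₂]
    (u : H₂) (v : H₁) : H₁ →L[ℂ] H₂ :=
  (innerSL ℂ v).smulRight u

/-- A `ℂ`-linear endomorphism `φ` of the space of compact operators `K(H₁,H₂)` is a
*bimodule endomorphism* if `φ (x ∘ a ∘ y) = x ∘ φ a ∘ y` for every `a ∈ K(H₁,H₂)` and
all compact operators `x ∈ K(H₂)`, `y ∈ K(H₁)`. -/
def IsBimoduleEnd (H₁ H₂ : Type*)
    [NormedAddCommGroup H₁] [InnerProductSpace ℂ H₁]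
    [NormedAddCommGroup H₂] [InnerProductSpace ℂ H₂]
    (φ : compactOperator (RingHom.id ℂ) H₁ H₂ →ₗ[ℂ] compactOperator (RingHom.id ℂ) H₁ H₂) :
    Prop :=
  ∀ (a b : compactOperator (RingHom.id ℂ) H₁ H₂)
    (x : H₂ →L[ℂ] H₂) (y : H₁ →L[ℂ] H₁),
    IsCompactOperator x → IsCompactOperator y →
    (b : H₁ →L[ℂ] H₂) = x.comp ((a : H₁ →L[ℂ] H₂).comp y) →
    (φ b : H₁ →L[ℂ] H₂) = x.comp ((φ a : H₁ →L[ℂ] H₂).comp y)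

theorem rankOne_isCompact {H : Type*} [NormedAddCommGroup H] [InnerProductSpace ℂ H]
    (c : ℂ) (u : H) : IsCompactOperator (c • rankOne u u : H →L[ℂ] H) := by
  have h1 : IsCompactOperator (ContinuousLinearMap.toSpanSingleton ℂ u : ℂ →L[ℂ] H) := by
    refine ⟨(ContinuousLinearMap.toSpanSingleton ℂ u : ℂ →L[ℂ] H) '' Metric.closedBall 0 1,
      (isCompact_closedBall 0 1).image (ContinuousLinearMap.continuous _), ?_⟩
    filter_upwards [Metric.closedBall_mem_nhds (0 : ℂ) one_pos] with z hz
    exact ⟨z, hz, rfl⟩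
  have h2 := (h1.comp_clm (innerSL ℂ u)).smul c
  exact h2

/-- Let `H₁`, `H₂` be nonzero separable complex Hilbert spaces and let `φ` be a
bimodule endomorphism of `K(H₁,H₂)`.  Then `φ` preserves the complex line of every rank-one
operator: for all `u ∈ H₂`, `v ∈ H₁`, if `r` is the rank-one operator `u ⊗ v̄` (viewed as a
compact operator), then there is `λ : ℂ` (depending on `u, v`) with `φ r = λ • r`. -/
theorem bimoduleEnd_preserves_rankOne_lines
    (H₁ H₂ : Type*)
    [NormedAddCommGroup H₁] [InnerProductSpace ℂ H₁] [CompleteSpace H₁]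
    [TopologicalSpace.SeparableSpace H₁] [Nontrivial H₁]
    [NormedAddCommGroup H₂] [InnerProductSpace ℂ H₂] [CompleteSpace H₂]
    [TopologicalSpace.SeparableSpace H₂] [Nontrivial H₂]
    (φ : compactOperator (RingHom.id ℂ) H₁ H₂ →ₗ[ℂ] compactOperator (RingHom.id ℂ) H₁ H₂)
    (hφ : IsBimoduleEnd H₁ H₂ φ) :
    ∀ (u : H₂) (v : H₁) (r : compactOperator (RingHom.id ℂ) H₁ H₂),
      (r : H₁ →L[ℂ] H₂) = rankOne u v → ∃ lam : ℂ, φ r = lam • r := by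
  intro u v r hr
  by_cases hu : u = 0
  · have : r = 0 := by
      apply Subtype.ext
      rw [hr, hu]
      ext w
      simp [rankOne]
    exact ⟨0, by simp [this]⟩
  by_cases hv : v = 0
  · have : r = 0 := by
      apply Subtype.ext
      rw [hr, hv]
      ext w
      simp [rankOne]
    exact ⟨0, by simp [this]⟩
  have hu' : inner ℂ u u ≠ 0 := inner_self_ne_zero.mpr hu
  have hv' : inner ℂ v v ≠ 0 := inner_self_ne_zero.mpr hv
  have key := hφ r r ((inner ℂ u u)⁻¹ • rankOne u u) ((inner ℂ v v)⁻¹ • rankOne v v)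
    (rankOne_isCompact _ u) (rankOne_isCompact _ v) (by
      rw [hr]
      ext w
      simp only [rankOne, ContinuousLinearMap.comp_apply, _root_.smul_apply,
        ContinuousLinearMap.smulRight_apply, innerSL_apply_apply, inner_smul_right, smul_smul]
      congr 1
      field_simp)
  refine ⟨(inner ℂ u u)⁻¹ * (inner ℂ v v)⁻¹ * inner ℂ u ((φ r : H₁ →L[ℂ] H₂) v), ?_⟩
  apply Subtype.ext
  rw [key]
  ext w
  rw [Submodule.coe_smul, hr]
  simp only [rankOne, ContinuousLinearMap.comp_apply, _root_.smul_apply,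
    ContinuousLinearMap.smulRight_apply, innerSL_apply_apply, map_smul, inner_smul_right, smul_smul]
  congr 1
  field_simp
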